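/- For every admissible deterministic online exploration strategy A and every ε > 0, there exist a grid polygon P (with holes) and a start cell s ∈ P edge-adjacent to a cell outside P such that S_A(P,s) ≥ (2 − ε) · S_OPT(P,s). Hence no online strategy for grid polygons with holes has a competitive factor smaller than 2. -/

import Mathlib

/-- A cell of the integer grid. -/
abbrev Cell : Type := ℤ × ℤ

/-- Two cells are edge-adjacent if they differ by exactly 1 in one coordinate
and 0 in the other. -/
def EdgeAdj (c d : Cell) : Prop :=
  (c.1 - d.1).natAbs + (c.2 - d.2).natAbs = 1

/-- Two cells are touching if they are distinct and differ by at most 1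
in each coordinate. -/
def Touching (c d : Cell) : Prop :=
  c ≠ d ∧ (c.1 - d.1).natAbs ≤ 1 ∧ (c.2 - d.2).natAbs ≤ 1

/-- A set of cells is connected under a relation `R` if any two of its members
are joined by a chain inside the set. -/
def ConnectedUnder (R : Cell → Cell → Prop) (S : Set Cell) : Prop :=
  ∀ c ∈ S, ∀ d ∈ S, Relation.ReflTransGen (fun a b => a ∈ S ∧ b ∈ S ∧ R a b) c d

/-- A grid polygon: a finite nonempty set of cells, connected under edge-adjacency. -/
def GridPolygon (P : Finset Cell) : Prop :=
  P.Nonempty ∧ ConnectedUnder EdgeAdj (↑P : Set Cell)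

/-- A simple grid polygon: a grid polygon whose complement is connected under
touching-adjacency (no holes). -/
def SimplePolygon (P : Finset Cell) : Prop :=
  GridPolygon P ∧ ConnectedUnder Touching ((↑P : Set Cell)ᶜ)

/-- The four edge-neighbors of a cell. -/
def nbrs (c : Cell) : Finset Cell :=
  {(c.1 + 1, c.2), (c.1 - 1, c.2), (c.1, c.2 + 1), (c.1, c.2 - 1)}

/-- The perimeter of a finite set of cells: the number of ordered pairs `(c, d)`
of edge-adjacent cells with `c ∈ S` and `d ∉ S`. -/
def perimeter (S : Finset Cell) : ℕ :=
  ∑ c ∈ S, ((nbrs c).filter (fun d => d ∉ S)).card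

/-- `w 0, …, w n` is a walk in `P`: all cells belong to `P` and consecutive
cells are edge-adjacent. -/
def IsWalk (P : Finset Cell) (w : ℕ → Cell) (n : ℕ) : Prop :=
  (∀ i ≤ n, w i ∈ P) ∧ ∀ i < n, EdgeAdj (w i) (w (i + 1))

/-- The walk `w 0, …, w n` covers `P`: every cell of `P` occurs among the `w i`. -/
def Covers (P : Finset Cell) (w : ℕ → Cell) (n : ℕ) : Prop :=
  ∀ c ∈ P, ∃ i ≤ n, w i = c

/-- The four compass directions. -/
inductive Dir : Type
  | north | east | south | west
deriving DecidableEq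

/-- Moving one cell in a given direction. -/
def move (c : Cell) : Dir → Cell
  | Dir.north => (c.1, c.2 + 1)
  | Dir.east  => (c.1 + 1, c.2)
  | Dir.south => (c.1, c.2 - 1)
  | Dir.west  => (c.1 - 1, c.2)

/-- A percept records, for each direction, whether the adjacent cell in that
direction belongs to the polygon. -/
abbrev Percept : Type := Dir → Bool

/-- The percept received at cell `c` in polygon `P`. -/
def percept (P : Finset Cell) (c : Cell) : Percept :=
  fun d => decide (move c d ∈ P)

/-- A deterministic online exploration strategy: from the finite sequence of
percepts received so far it outputs the next direction, or `none` to stop. -/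
abbrev Strategy : Type := List Percept → Option Dir

/-- The state (current cell, percept history of previously visited cells) of a
strategy run in `P` from `s` after `n` steps.  At each step the percept of the
current cell is appended to the history and the strategy is applied to it. -/
def strState (A : Strategy) (P : Finset Cell) (s : Cell) : ℕ → Cell × List Percept
  | 0 => (s, [])
  | n + 1 =>
    let p := strState A P s n
    let h' := p.2 ++ [percept P p.1]
    match A h' with
    | none => (p.1, h')
    | some d => (move p.1 d, h')

/-- The cell visited at time `n` of the run of strategy `A` in `P` from `s`. -/
def traj (A : Strategy) (P : Finset Cell) (s : Cell) (n : ℕ) : Cell :=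
  (strState A P s n).1

/-- The percept history used for the decision at time `n`. -/
def histAt (A : Strategy) (P : Finset Cell) (s : Cell) (n : ℕ) : List Percept :=
  (strState A P s n).2 ++ [percept P (traj A P s n)]

/-- The run of `A` in `P` from `s` stops after exactly `n` steps:
the strategy outputs a direction at all times `i < n` and stops at time `n`.
Then `n` is the length `S_A(P,s)` of the generated walk `traj 0, …, traj n`. -/
def StopsAt (A : Strategy) (P : Finset Cell) (s : Cell) (n : ℕ) : Prop :=
  A (histAt A P s n) = none ∧ ∀ i < n, A (histAt A P s i) ≠ none

/-- `A` is admissible: in every grid polygon `P`, started at a cell `s ∈ P`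
edge-adjacent to a cell outside `P`, the generated walk is finite, stays in
`P`, returns to `s`, and covers `P`. -/
def Admissible (A : Strategy) : Prop :=
  ∀ P : Finset Cell, ∀ s : Cell, GridPolygon P → s ∈ P →
    (∃ d, d ∉ P ∧ EdgeAdj s d) →
    ∃ n : ℕ, StopsAt A P s n ∧ (∀ i ≤ n, traj A P s i ∈ P) ∧
      traj A P s n = s ∧ ∀ c ∈ P, ∃ i ≤ n, traj A P s i = c


theorem edgeAdj_iff (c d : Cell) : EdgeAdj c d ↔
    (d.1 = c.1 + 1 ∧ d.2 = c.2) ∨ (d.1 = c.1 - 1 ∧ d.2 = c.2) ∨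
    (d.1 = c.1 ∧ d.2 = c.2 + 1) ∨ (d.1 = c.1 ∧ d.2 = c.2 - 1) := by
  unfold EdgeAdj
  omega

theorem edgeAdj_move (c : Cell) (d : Dir) : EdgeAdj c (move c d) := by
  rw [edgeAdj_iff]
  cases d <;> simp [move]

theorem stops_unique {A : Strategy} {P : Finset Cell} {s : Cell} {n m : ℕ}
    (h1 : StopsAt A P s n) (h2 : StopsAt A P s m) : n = m := by
  rcases lt_trichotomy n m with h | h | h
  · exact absurd h1.1 (h2.2 n h)
  · exact h
  · exact absurd h2.1 (h1.2 m h)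

theorem traj_step {A : Strategy} {P : Finset Cell} {s : Cell} {n i : ℕ}
    (h1 : StopsAt A P s n) (hi : i < n) :
    EdgeAdj (traj A P s i) (traj A P s (i + 1)) := by
  have h := h1.2 i hi
  unfold histAt traj at h
  unfold traj
  simp only [strState]
  cases hA : A ((strState A P s i).2 ++ [percept P (strState A P s i).1]) with
  | none => exact absurd hA h
  | some d => exact edgeAdj_move _ _

theorem state_agree {A : Strategy} {P Q : Finset Cell} {s : Cell} {t : ℕ}
    (h : ∀ i < t, percept P (traj A Q s i) = percept Q (traj A Q s i)) :
    ∀ i ≤ t, strState A P s i = strState A Q s i := by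
  intro i
  induction i with
  | zero => intro _; rfl
  | succ k ih =>
    intro hk
    have e := ih (by omega)
    have hp := h k (by omega)
    unfold traj at hp
    simp only [strState, e, hp]

/-- a closed excursion into `S` has an entering and a leaving step -/
theorem excursion (w : ℕ → Cell) (S : Set Cell) (a b c : ℕ) (hac : a ≤ c) (hcb : c ≤ b)
    (ha : w a ∉ S) (hb : w b ∉ S) (hc : w c ∈ S) :
    ∃ i j, a ≤ i ∧ i < b ∧ a ≤ j ∧ j < b ∧ (w i ∉ S ∧ w (i + 1) ∈ S) ∧
      (w j ∈ S ∧ w (j + 1) ∉ S) := by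
  have h1 : ∃ i, a ≤ i ∧ i < c ∧ (w i ∉ S ∧ w (i + 1) ∈ S) := by
    by_contra hcon
    have : ∀ d, a + d ≤ c → w (a + d) ∉ S := by
      intro d
      induction d with
      | zero => intro _; exact ha
      | succ d ih =>
        intro hd hS
        exact hcon ⟨a + d, by omega, by omega, ih (by omega), hS⟩
    have h := this (c - a) (by omega)
    rw [show a + (c - a) = c by omega] at h
    exact h hc
  have h2 : ∃ j, c ≤ j ∧ j < b ∧ (w j ∈ S ∧ w (j + 1) ∉ S) := by
    by_contra hcon
    have : ∀ d, c + d ≤ b → w (c + d) ∈ S := by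
      intro d
      induction d with
      | zero => intro _; exact hc
      | succ d ih =>
        intro hd
        by_contra hS
        exact hcon ⟨c + d, by omega, by omega, ih (by omega), hS⟩
    have h := this (b - c) (by omega)
    rw [show c + (b - c) = b by omega] at h
    exact hb h
  obtain ⟨i, h1, h2', h3⟩ := h1
  obtain ⟨j, h4, h5, h6⟩ := h2
  exact ⟨i, j, h1, by omega, by omega, h5, h3, h6⟩

def Crosses (S : Set Cell) (c d : Cell) : Prop := (c ∉ S ∧ d ∈ S) ∨ (c ∈ S ∧ d ∉ S)

open Classical in
theorem count_cuts {ι : Type} (E : Finset ι) (S : ι → Set Cell) (w : ℕ → Cell) (t n : ℕ)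
    (h0 : ∀ e ∈ E, w 0 ∉ S e) (ht : ∀ e ∈ E, w t ∉ S e) (hn : ∀ e ∈ E, w n ∉ S e)
    (hv : ∀ e ∈ E, ∃ i ≤ t, w i ∈ S e) (hv2 : ∀ e ∈ E, ∃ i, t ≤ i ∧ i ≤ n ∧ w i ∈ S e)
    (hx : ∀ i < n, ∀ e ∈ E, ∀ e' ∈ E, Crosses (S e) (w i) (w (i + 1)) →
      Crosses (S e') (w i) (w (i + 1)) → e = e') :
    4 * E.card ≤ n := by
  let F : ι → Finset ℕ := fun e => (Finset.range n).filter (fun i => Crosses (S e) (w i) (w (i+1)))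
  have hF : ∀ e ∈ E, 4 ≤ (F e).card := by
    intro e he
    obtain ⟨c, hc, hcS⟩ := hv e he
    obtain ⟨c', hc1, hc2, hcS'⟩ := hv2 e he
    obtain ⟨i1, j1, a1, a2, a3, a4, a5, a6⟩ :=
      excursion w (S e) 0 t c (by omega) hc (h0 e he) (ht e he) hcS
    obtain ⟨i2, j2, b1, b2, b3, b4, b5, b6⟩ :=
      excursion w (S e) t n c' hc1 hc2 (ht e he) (hn e he) hcS'
    have hsub : ({i1, j1, i2, j2} : Finset ℕ) ⊆ F e := by
      intro z hz
      simp only [Finset.mem_insert, Finset.mem_singleton] at hz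
      simp only [F, Finset.mem_filter, Finset.mem_range]
      rcases hz with rfl | rfl | rfl | rfl
      · exact ⟨by omega, Or.inl a5⟩
      · exact ⟨by omega, Or.inr a6⟩
      · exact ⟨by omega, Or.inl b5⟩
      · exact ⟨by omega, Or.inr b6⟩
    have n1 : i1 ≠ j1 := by rintro rfl; exact a5.1 a6.1
    have n2 : i2 ≠ j2 := by rintro rfl; exact b5.1 b6.1
    have hcard : ({i1, j1, i2, j2} : Finset ℕ).card = 4 := by
      rw [Finset.card_eq_succ]
      refine ⟨i1, {j1, i2, j2}, ?_, rfl, ?_⟩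
      · simp; omega
      · rw [Finset.card_eq_three]
        exact ⟨j1, i2, j2, by omega, by omega, n2, rfl⟩
    rw [← hcard]
    exact Finset.card_le_card hsub
  have hdis : (E : Set ι).PairwiseDisjoint F := by
    intro e he e' he' hne
    rw [Function.onFun, Finset.disjoint_left]
    intro i hi hi'
    simp only [F, Finset.mem_filter, Finset.mem_range] at hi hi'
    exact hne (hx i hi.1 e he e' he' hi.2 hi'.2)
  have h1 : (E.biUnion F).card = ∑ e ∈ E, (F e).card := Finset.card_biUnion hdis
  have h2 : (E.biUnion F).card ≤ n := by
    have : E.biUnion F ⊆ Finset.range n := by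
      intro i hi
      simp only [F, Finset.mem_biUnion, Finset.mem_filter] at hi
      obtain ⟨_, _, h, _⟩ := hi
      exact h
    simpa using Finset.card_le_card this
  have h3 : E.card * 4 ≤ ∑ e ∈ E, (F e).card := by
    have := Finset.card_nsmul_le_sum E (fun e => (F e).card) 4 hF
    simpa using this
  omega

theorem adversary {A : Strategy} (hA : Admissible A) {P Q : Finset Cell} {s : Cell}
    {nQ t : ℕ} (hQ : StopsAt A Q s nQ) (htQ : t ≤ nQ)
    (hP : GridPolygon P) (hs : s ∈ P) (hd : ∃ d, d ∉ P ∧ EdgeAdj s d)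
    (hag : ∀ i < t, percept P (traj A Q s i) = percept Q (traj A Q s i))
    {ι : Type} (E : Finset ι) (S : ι → Set Cell)
    (h0 : ∀ e ∈ E, s ∉ S e) (ht : ∀ e ∈ E, traj A Q s t ∉ S e)
    (hv : ∀ e ∈ E, ∃ i ≤ t, traj A Q s i ∈ S e)
    (hu : ∀ e ∈ E, ∃ c ∈ P, c ∈ S e ∧ ∀ i ≤ t, traj A Q s i ≠ c)
    (hx : ∀ c ∈ P, ∀ d ∈ P, EdgeAdj c d → ∀ e ∈ E, ∀ e' ∈ E, Crosses (S e) c d →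
      Crosses (S e') c d → e = e')
    (n : ℕ) (hn : StopsAt A P s n) : 4 * E.card ≤ n := by
  obtain ⟨n', hn', hin, hret, hcov⟩ := hA P s hP hs hd
  obtain rfl := stops_unique hn hn'
  have hst := state_agree hag
  have htr : ∀ i ≤ t, traj A P s i = traj A Q s i := by
    intro i hi; unfold traj; rw [hst i hi]
  have htn : t ≤ n := by
    by_contra hlt
    push Not at hlt
    have h1 := hn.1
    have h2 := hQ.2 n (by omega)
    have : histAt A P s n = histAt A Q s n := by
      unfold histAt
      rw [hst n hlt.le, htr n hlt.le, hag n hlt]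
    rw [this] at h1
    exact h2 h1
  refine count_cuts E S (traj A P s) t n ?_ ?_ ?_ ?_ ?_ ?_
  · intro e he; exact h0 e he
  · intro e he; rw [htr t le_rfl]; exact ht e he
  · intro e he; rw [hret]; exact h0 e he
  · intro e he
    obtain ⟨i, hi, h⟩ := hv e he
    exact ⟨i, hi, by rw [htr i hi]; exact h⟩
  · intro e he
    obtain ⟨c, hcP, hcS, hc⟩ := hu e he
    obtain ⟨i, hi, rfl⟩ := hcov c hcP
    refine ⟨i, ?_, hi, hcS⟩
    by_contra hlt
    exact hc i (by omega) (htr i (by omega)).symm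
  · intro i hi e he e' he'
    exact hx _ (hin i hi.le) _ (hin (i+1) hi) (traj_step hn hi) e he e' he'

theorem edgeAdj_symm {c d : Cell} (h : EdgeAdj c d) : EdgeAdj d c := by
  rw [edgeAdj_iff] at *; omega

/-- inserting detours -/
theorem detour {P : Finset Cell} (hP : GridPolygon P) (s : Cell) (hs : s ∈ P) :
    ∀ (r : ℕ) (U : Finset Cell) (w : ℕ → Cell) (k : ℕ), (P \ U).card ≤ r →
      w 0 = s → IsWalk P w k → w k = s → (∀ c ∈ U, ∃ i ≤ k, w i = c) →
      ∃ k', k' ≤ k + 2 * r ∧ ∃ w' : ℕ → Cell, w' 0 = s ∧ IsWalk P w' k' ∧ w' k' = s ∧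
        Covers P w' k' := by
  intro r
  induction r with
  | zero =>
    intro U w k hr h0 hw hk hc
    refine ⟨k, by omega, w, h0, hw, hk, ?_⟩
    intro c hcP
    apply hc
    rw [Nat.le_zero, Finset.card_eq_zero, Finset.sdiff_eq_empty_iff_subset] at hr
    exact hr hcP
  | succ r ih =>
    intro U w k hr h0 hw hk hc
    have hcard : ∀ c ∈ P, c ∉ U → (P \ insert c U).card ≤ r := by
      intro c hcP hcU
      have : P \ insert c U ⊂ P \ U := by
        rw [Finset.ssubset_iff_of_subset
          (Finset.sdiff_subset_sdiff le_rfl (Finset.subset_insert _ _))]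
        exact ⟨c, by simp [hcP, hcU], by simp⟩
      have := Finset.card_lt_card this
      omega
    by_cases hcov : Covers P w k
    · exact ⟨k, by omega, w, h0, hw, hk, hcov⟩
    by_cases hall : ∃ c ∈ P, c ∉ U ∧ ∃ i ≤ k, w i = c
    · obtain ⟨c, hcP, hcU, i, hi, hic⟩ := hall
      obtain ⟨k', hk', w', h⟩ := ih (insert c U) w k (hcard c hcP hcU) h0 hw hk (by
        intro d hd
        rcases Finset.mem_insert.1 hd with rfl | hd
        · exact ⟨i, hi, hic⟩
        · exact hc d hd)
      exact ⟨k', by omega, w', h⟩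
    · have hadj : ∃ t ≤ k, ∃ u ∈ P, EdgeAdj (w t) u ∧ ∀ i ≤ k, w i ≠ u := by
        by_contra hcon
        apply hcov
        intro c hcP
        have hch := hP.2 s hs c hcP
        induction hch with
        | refl => exact ⟨0, by omega, h0⟩
        | tail _ hstep ih2 =>
          obtain ⟨h1, h2, h3⟩ := hstep
          obtain ⟨i, hi, hib⟩ := ih2 h1
          by_contra hno
          apply hcon
          refine ⟨i, hi, _, h2, by rw [hib]; exact h3, ?_⟩
          intro j hj hju
          exact hno ⟨j, hj, hju⟩
      obtain ⟨t, ht, u, huP, hadj, hnew⟩ := hadj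
      have huU : u ∉ U := by
        intro h
        obtain ⟨i, hi, h'⟩ := hc u h
        exact hnew i hi h'
      let w2 : ℕ → Cell := fun i => if i ≤ t then w i else if i = t + 1 then u else w (i - 2)
      have hlo : ∀ i ≤ t, w2 i = w i := fun i hi => by simp [w2, hi]
      have hmid : w2 (t + 1) = u := by simp [w2]
      have hhi : ∀ i, t ≤ i → w2 (i + 2) = w i := fun i hi => by
        simp only [w2]
        rw [if_neg (by omega), if_neg (by omega)]
        rfl
      have hwalk : IsWalk P w2 (k + 2) := by
        refine ⟨?_, ?_⟩
        · intro i hi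
          by_cases h1 : i ≤ t
          · rw [hlo i h1]; exact hw.1 i (by omega)
          · by_cases h2 : i = t + 1
            · subst h2; rw [hmid]; exact huP
            · obtain ⟨j, rfl⟩ : ∃ j, i = j + 2 := ⟨i - 2, by omega⟩
              rw [hhi j (by omega)]; exact hw.1 j (by omega)
        · intro i hi
          by_cases h1 : i < t
          · rw [hlo i h1.le, hlo (i+1) h1]; exact hw.2 i (by omega)
          · by_cases h2 : i = t
            · subst h2; rw [hlo i le_rfl, hmid]; exact hadj
            · by_cases h3 : i = t + 1
              · subst h3
                rw [hmid, hhi t le_rfl]; exact edgeAdj_symm hadj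
              · obtain ⟨j, rfl⟩ : ∃ j, i = j + 2 := ⟨i - 2, by omega⟩
                rw [hhi j (by omega), show j + 2 + 1 = (j + 1) + 2 by ring, hhi (j+1) (by omega)]
                exact hw.2 j (by omega)
      obtain ⟨k', hk', w', h⟩ := ih (insert u U) w2 (k + 2) (hcard u huP huU)
        (by rw [hlo 0 (by omega)]; exact h0) hwalk
        (by rw [hhi k ht]; exact hk) (by
        intro d hd
        rcases Finset.mem_insert.1 hd with rfl | hd
        · exact ⟨t + 1, by omega, hmid⟩
        · obtain ⟨i, hi, h'⟩ := hc d hd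
          by_cases hit : i ≤ t
          · exact ⟨i, by omega, by rw [hlo i hit]; exact h'⟩
          · exact ⟨i + 2, by omega, by rw [hhi i (by omega)]; exact h'⟩)
      exact ⟨k', by omega, w', h⟩

theorem connected_of_rank {P : Finset Cell} (s : Cell) (hs : s ∈ P) (rk : Cell → ℕ)
    (h : ∀ c ∈ P, c ≠ s → ∃ p ∈ P, EdgeAdj c p ∧ rk p < rk c) : GridPolygon P := by
  refine ⟨⟨s, hs⟩, ?_⟩
  have key : ∀ n, ∀ c ∈ P, rk c ≤ n → Relation.ReflTransGen
      (fun a b => a ∈ (↑P : Set Cell) ∧ b ∈ (↑P : Set Cell) ∧ EdgeAdj a b) c s := by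
    intro n
    induction n with
    | zero =>
      intro c hc hr
      by_cases hcs : c = s
      · rw [hcs]
      · obtain ⟨p, _, _, hp⟩ := h c hc hcs
        omega
    | succ n ih =>
      intro c hc hr
      by_cases hcs : c = s
      · rw [hcs]
      · obtain ⟨p, hp, hadj, hrk⟩ := h c hc hcs
        exact Relation.ReflTransGen.head ⟨hc, hp, hadj⟩ (ih p hp (by omega))
  have hsym : ∀ c, ∀ d, Relation.ReflTransGen
      (fun a b => a ∈ (↑P : Set Cell) ∧ b ∈ (↑P : Set Cell) ∧ EdgeAdj a b) c d →
      Relation.ReflTransGen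
      (fun a b => a ∈ (↑P : Set Cell) ∧ b ∈ (↑P : Set Cell) ∧ EdgeAdj a b) d c := by
    intro c d hcd
    induction hcd with
    | refl => exact Relation.ReflTransGen.refl
    | tail _ hs ih => exact Relation.ReflTransGen.head ⟨hs.2.1, hs.1, edgeAdj_symm hs.2.2⟩ ih
  intro c hc d hd
  exact (key _ c hc le_rfl).trans (hsym _ _ (key _ d hd le_rfl))

noncomputable def PP (N : ℤ) (L R : ℤ → ℤ) : Finset Cell :=
  ((Finset.Icc 0 N) ×ˢ (Finset.Icc (-2 : ℤ) 2)).filter (fun c =>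
    (c.2 % 2 = 0 ∨ c.1 = 0 ∨ c.1 = N) ∧ (c.1 ≤ L c.2 + 1 ∨ R c.2 - 1 ≤ c.1))

theorem mem_PP {N : ℤ} {L R : ℤ → ℤ} {c : Cell} : c ∈ PP N L R ↔
    (0 ≤ c.1 ∧ c.1 ≤ N) ∧ (-2 ≤ c.2 ∧ c.2 ≤ 2) ∧
    (c.2 % 2 = 0 ∨ c.1 = 0 ∨ c.1 = N) ∧ (c.1 ≤ L c.2 + 1 ∨ R c.2 - 1 ≤ c.1) := by
  simp only [PP, Finset.mem_filter, Finset.mem_product, Finset.mem_Icc]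
  tauto

noncomputable def Theta (N : ℤ) : Finset Cell := PP N (fun _ => N) (fun _ => N)

theorem mem_Theta {N : ℤ} {c : Cell} : c ∈ Theta N ↔
    (0 ≤ c.1 ∧ c.1 ≤ N) ∧ (-2 ≤ c.2 ∧ c.2 ≤ 2) ∧
    (c.2 % 2 = 0 ∨ c.1 = 0 ∨ c.1 = N) := by
  rw [Theta, mem_PP]
  omega

def Shape (N i : ℤ) (L R : ℤ → ℤ) : Prop :=
  (∀ y, 0 ≤ L y) ∧ (∀ y, y % 2 ≠ 0 → L y = 0) ∧ (((∀ y, N + 1 < R y) ∧ (∀ y, L y < N)) ∨ ((∀ y, R y ≤ N) ∧ N ≤ L i))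

theorem PP_start {N i : ℤ} {L R : ℤ → ℤ} (hN : 0 ≤ N) (h : Shape N i L R) :
    ((0, 0) : Cell) ∈ PP N L R ∧ ∃ d, d ∉ PP N L R ∧ EdgeAdj (0, 0) d := by
  have := h.1 0
  refine ⟨?_, (-1, 0), ?_, ?_⟩
  · rw [mem_PP]; simp; omega
  · rw [mem_PP]; simp
  · rw [edgeAdj_iff]; simp

theorem PP_connected {N i : ℤ} {L R : ℤ → ℤ} (hN : 2 ≤ N) (hi : -2 ≤ i ∧ i ≤ 2)
    (h : Shape N i L R) : GridPolygon (PP N L R) := by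
  refine connected_of_rank (0, 0) (PP_start (by omega) h).1
    (fun c => if c.1 ≤ L c.2 + 1 then c.1.toNat + c.2.natAbs
      else (N + 3 + (N - c.1)).toNat + (c.2 - i).natAbs) ?_
  rintro ⟨x, y⟩ hc hne
  rw [mem_PP] at hc
  have hne' : ¬ (x = 0 ∧ y = 0) := by
    rintro ⟨rfl, rfl⟩; exact hne rfl
  simp only at hc ⊢
  obtain ⟨h0, hodd, hsh⟩ := h
  by_cases hl : x ≤ L y + 1
  · rw [if_pos hl]
    by_cases hx : x = 0
    · subst hx
      rcases lt_or_gt_of_ne (show y ≠ 0 by tauto) with hy | hy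
      · have := h0 (y + 1)
        refine ⟨(0, y + 1), ?_, ?_, ?_⟩
        · have := h0 y; rw [mem_PP]; simp only [true_or, or_true, true_and]; omega
        · rw [edgeAdj_iff]; simp
        · simp only; split_ifs <;> omega
      · have := h0 (y - 1)
        refine ⟨(0, y - 1), ?_, ?_, ?_⟩
        · have := h0 y; rw [mem_PP]; simp only [true_or, or_true, true_and]; omega
        · rw [edgeAdj_iff]; simp
        · simp only; split_ifs <;> omega
    · by_cases hy : y % 2 = 0
      · refine ⟨(x - 1, y), ?_, ?_, ?_⟩
        · have := h0 y; rw [mem_PP]; simp only [true_or, or_true, true_and]; omega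
        · rw [edgeAdj_iff]; simp
        · simp only; split_ifs <;> omega
      · have hxN : x = N := by omega
        have := hodd y hy
        omega
  · rw [if_neg hl]
    rcases hsh with ⟨h1, h2⟩ | ⟨h1, h2⟩
    · have := h1 y; omega
    · by_cases hxN : x = N
      · subst hxN
        rcases lt_trichotomy y i with hy | hy | hy
        · have := h1 (y + 1)
          refine ⟨(x, y + 1), ?_, ?_, ?_⟩
          · have := h0 y; rw [mem_PP]; simp only [true_or, or_true, true_and]; omega
          · rw [edgeAdj_iff]; simp
          · simp only; split_ifs <;> omega
        · subst hy; omega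
        · have := h1 (y - 1)
          refine ⟨(x, y - 1), ?_, ?_, ?_⟩
          · have := h0 y; rw [mem_PP]; simp only [true_or, or_true, true_and]; omega
          · rw [edgeAdj_iff]; simp
          · simp only; split_ifs <;> omega
      · refine ⟨(x + 1, y), ?_, ?_, ?_⟩
        · have := h0 y; rw [mem_PP]; simp only [true_or, or_true, true_and]; omega
        · rw [edgeAdj_iff]; simp
        · simp only; split_ifs <;> omega

theorem PP_agree {N i : ℤ} {L R : ℤ → ℤ} (hN : 2 ≤ N) (h : Shape N i L R) {c : Cell}
    (hc : c ∈ Theta N) (hv : c.1 ≤ L c.2 ∨ R c.2 ≤ c.1) :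
    percept (PP N L R) c = percept (Theta N) c := by
  obtain ⟨x, y⟩ := c
  rw [mem_Theta] at hc
  obtain ⟨h0, hodd, hsh⟩ := h
  funext d
  unfold percept
  rw [decide_eq_decide, mem_PP, mem_Theta]
  have a1 := h0 (y + 1)
  have a2 := h0 (y - 1)
  simp only at hc hv
  rcases hsh with ⟨h1, h2⟩ | ⟨h1, h2⟩
  · have b0 := h1 y
    have b1 := h1 (y + 1)
    have b2 := h1 (y - 1)
    have c0 := h2 y
    cases d <;> simp only [move] <;> omega
  · have b1 := h1 (y + 1)
    have b2 := h1 (y - 1)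
    cases d <;> simp only [move] <;> omega

theorem final_arith (ε : ℝ) (C E m n : ℕ) (hε : 0 < ε) (hm : m ≤ 2 * E + C) (hn : 4 * E ≤ n)
    (hC : (C : ℝ) ≤ ε * E) : (2 - ε) * (m : ℝ) ≤ (n : ℝ) := by
  have hm' : (m : ℝ) ≤ 2 * E + C := by exact_mod_cast hm
  have hn' : 4 * (E : ℝ) ≤ n := by exact_mod_cast hn
  have m0 : (0 : ℝ) ≤ m := Nat.cast_nonneg _
  have n0 : (0 : ℝ) ≤ n := Nat.cast_nonneg _
  have C0 : (0 : ℝ) ≤ C := Nat.cast_nonneg _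
  have E0 : (0 : ℝ) ≤ E := Nat.cast_nonneg _
  rcases le_or_gt 2 ε with h | h
  · nlinarith
  · nlinarith [mul_le_mul_of_nonneg_left hm' (show 0 ≤ 2 - ε by linarith), mul_nonneg hε.le C0]

theorem exists_L (w : ℕ → Cell) (t : ℕ) (y B : ℤ) (hB : 0 ≤ B) :
    ∃ l : ℤ, 0 ≤ l ∧ l ≤ B ∧ (l = 0 ∨ ∃ u ≤ t, w u = (l, y)) ∧
      ∀ u ≤ t, (w u).2 = y → (w u).1 ≤ B → (w u).1 ≤ l := by
  induction t with
  | zero =>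
    by_cases h : (w 0).2 = y ∧ 0 ≤ (w 0).1 ∧ (w 0).1 ≤ B
    · refine ⟨(w 0).1, h.2.1, h.2.2, Or.inr ⟨0, le_rfl, by rw [← h.1]⟩, ?_⟩
      intro u hu _ _
      obtain rfl : u = 0 := by omega
      exact le_rfl
    · refine ⟨0, le_rfl, hB, Or.inl rfl, ?_⟩
      intro u hu h1 h2
      obtain rfl : u = 0 := by omega
      by_contra h3
      exact h ⟨h1, by omega, h2⟩
  | succ t ih =>
    obtain ⟨l, h1, h2, h3, h4⟩ := ih
    by_cases h : (w (t+1)).2 = y ∧ l ≤ (w (t+1)).1 ∧ (w (t+1)).1 ≤ B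
    · refine ⟨(w (t+1)).1, by omega, h.2.2, Or.inr ⟨t+1, le_rfl, by rw [← h.1]⟩, ?_⟩
      intro u hu h5 h6
      rcases Nat.lt_or_ge t u with hlt | hle
      · obtain rfl : u = t + 1 := by omega
        exact le_rfl
      · exact (h4 u hle h5 h6).trans h.2.1
    · refine ⟨l, h1, h2, ?_, ?_⟩
      · rcases h3 with h3 | ⟨u, hu, h3⟩
        · exact Or.inl h3
        · exact Or.inr ⟨u, by omega, h3⟩
      · intro u hu h5 h6
        rcases Nat.lt_or_ge t u with hlt | hle
        · obtain rfl : u = t + 1 := by omega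
          by_contra h7
          exact h ⟨h5, by omega, h6⟩
        · exact h4 u hle h5 h6

theorem exists_R (w : ℕ → Cell) (t : ℕ) (y B N : ℤ) (hB : B ≤ N) :
    ∃ r : ℤ, r ≤ N ∧ B ≤ r ∧ (r = N ∨ ∃ u ≤ t, w u = (r, y)) ∧
      ∀ u ≤ t, (w u).2 = y → B ≤ (w u).1 → r ≤ (w u).1 := by
  obtain ⟨l, h1, h2, h3, h4⟩ := exists_L (fun u => (N - (w u).1, (w u).2)) t y (N - B) (by omega)
  refine ⟨N - l, by omega, by omega, ?_, ?_⟩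
  · rcases h3 with h3 | ⟨u, hu, h3⟩
    · left; omega
    · right
      refine ⟨u, hu, ?_⟩
      simp only [Prod.mk.injEq] at h3
      ext
      · simp only; omega
      · exact h3.2
  · intro u hu h5 h6
    have := h4 u hu h5 (by simp only; omega)
    simp only at this
    omega

theorem phases (N K : ℤ) (hK : 1 ≤ K) (hKN : K + 4 ≤ N) (w : ℕ → Cell) (n : ℕ)
    (hin : ∀ i ≤ n, w i ∈ Theta N) (hst : ∀ i < n, EdgeAdj (w i) (w (i + 1)))
    (h0 : w 0 = (0, 0)) (hn : w n = (0, 0)) (hc : ∃ i ≤ n, w i = (N, 0)) :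
    ∃ t ≤ n, ∃ i : ℤ, (i % 2 = 0 ∧ -2 ≤ i ∧ i ≤ 2) ∧ (∃ u ≤ t, w u = (K, i)) ∧
      (∀ u < t, (w u).1 < K ∨ (w u).2 = i ∨ K + 3 ≤ (w u).1) ∧
      ((∃ u < t, w u = (N, i)) ∨ ∀ u ≤ t, (w u).1 < K ∨ (w u).2 = i) ∧
      (w t = (0, i) ∨ ∃ j, j ≠ i ∧ w t = (K + 2, j)) := by
  classical
  have hex : ∃ t, t ≤ n ∧ K ≤ (w t).1 := by
    obtain ⟨i, hi, h⟩ := hc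
    exact ⟨i, hi, by rw [h]; simp only; omega⟩
  obtain ⟨t1, ⟨ht1n, ht1⟩, hmin⟩ : ∃ t1, (t1 ≤ n ∧ K ≤ (w t1).1) ∧ ∀ u < t1, (w u).1 < K := by
    refine ⟨Nat.find hex, Nat.find_spec hex, fun u hu => ?_⟩
    have h1 := Nat.find_min hex hu
    have h2 := (Nat.find_spec hex).1
    by_contra h3
    exact h1 ⟨by omega, by omega⟩
  have hpos : 0 < t1 := by
    rcases Nat.eq_zero_or_pos t1 with h | h
    · rw [h, h0] at ht1; simp only at ht1; omega
    · exact h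
  have hx1 : (w t1).1 = K := by
    have h1 := hmin (t1 - 1) (by omega)
    have h2 := hst (t1 - 1) (by omega)
    rw [show t1 - 1 + 1 = t1 by omega, edgeAdj_iff] at h2
    omega
  have hmem1 := mem_Theta.1 (hin t1 ht1n)
  set i := (w t1).2 with hi
  have hi2 : i % 2 = 0 := by omega
  let Ev : ℕ → Prop := fun t => w t = (0, i) ∨ ∃ j, j ≠ i ∧ w t = (K + 2, j)
  have hinv : ∀ d, t1 + d ≤ n → (∀ u, t1 ≤ u → u ≤ t1 + d → ¬ Ev u) →
      ((w (t1 + d)).2 = i ∧ 1 ≤ (w (t1 + d)).1) ∨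
      ((w (t1 + d)).2 ≠ i ∧ K + 3 ≤ (w (t1 + d)).1) := by
    intro d
    induction d with
    | zero => intro _ _; left; exact ⟨rfl, by rw [Nat.add_zero]; omega⟩
    | succ d ih =>
      intro hd hE
      have h1 := ih (by omega) (fun u hu1 hu2 => hE u hu1 (by omega))
      have h2 := hst (t1 + d) (by omega)
      have h3 := hE (t1 + d + 1) (by omega) (by omega)
      have h4 := mem_Theta.1 (hin (t1 + d) (by omega))
      have h5 := mem_Theta.1 (hin (t1 + d + 1) (by omega))
      rw [edgeAdj_iff] at h2
      rw [← Nat.add_assoc]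
      have h6 : ¬ ((w (t1 + d + 1)).1 = 0 ∧ (w (t1 + d + 1)).2 = i) := by
        rintro ⟨a, b⟩; exact h3 (Or.inl (Prod.ext a b))
      have h7 : ¬ ((w (t1 + d + 1)).1 = K + 2 ∧ (w (t1 + d + 1)).2 ≠ i) := by
        rintro ⟨a, b⟩; exact h3 (Or.inr ⟨_, b, Prod.ext a rfl⟩)
      omega
  have hex2 : ∃ t, t1 ≤ t ∧ t ≤ n ∧ Ev t := by
    by_contra hcon
    have := hinv (n - t1) (by omega) (fun u h1 h2 h3 => hcon ⟨u, h1, by omega, h3⟩)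
    rw [show t1 + (n - t1) = n by omega, hn] at this
    simp only at this
    omega
  obtain ⟨t, ⟨htt, htn, hEv⟩, hmin2⟩ : ∃ t, (t1 ≤ t ∧ t ≤ n ∧ Ev t) ∧
      ∀ u, t1 ≤ u → u < t → ¬ Ev u := by
    refine ⟨Nat.find hex2, Nat.find_spec hex2, fun u hu1 hu h => ?_⟩
    have h2 := (Nat.find_spec hex2).2.1
    exact Nat.find_min hex2 hu ⟨hu1, by omega, h⟩
  refine ⟨t, htn, i, ⟨hi2, hmem1.2.1⟩, ⟨t1, htt, Prod.ext hx1 rfl⟩, ?_, ?_, hEv⟩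
  · intro u hu
    rcases Nat.lt_or_ge u t1 with h | h
    · exact Or.inl (hmin u h)
    · have := hinv (u - t1) (by omega) (fun v h1 h2 => hmin2 v h1 (by omega))
      rw [show t1 + (u - t1) = u by omega] at this
      omega
  · by_cases hN : ∃ u < t, w u = (N, i)
    · exact Or.inl hN
    · right
      have key : ∀ d, t1 + d ≤ t → (w (t1 + d)).2 = i := by
        intro d
        induction d with
        | zero => intro _; rfl
        | succ d ih =>
          intro hd
          have h1 := ih (by omega)
          have h2 := hst (t1 + d) (by omega)
          have h4 := mem_Theta.1 (hin (t1 + d) (by omega))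
          have h5 := mem_Theta.1 (hin (t1 + d + 1) (by omega))
          have h6 : (w (t1 + d)).1 ≠ N := fun h =>
            hN ⟨t1 + d, by omega, Prod.ext h h1⟩
          have h7 := hinv d (by omega) (fun v h1 h2 => hmin2 v h1 (by omega))
          rw [edgeAdj_iff] at h2
          rw [← Nat.add_assoc]
          omega
      intro u hu
      rcases Nat.lt_or_ge u t1 with h | h
      · exact Or.inl (hmin u h)
      · have := key (u - t1) (by omega)
        rw [show t1 + (u - t1) = u by omega] at this
        exact Or.inr this

def cutA (K i : ℤ) (e : Cell) : Set Cell :=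
  {c | (e.2 = i ∧ ((c.2 = i ∧ e.1 ≤ c.1) ∨ (c.2 ≠ i ∧ K + 1 ≤ c.1))) ∨
    (e.2 ≠ i ∧ c.2 = e.2 ∧ ((e.1 ≤ K ∧ e.1 ≤ c.1 ∧ c.1 ≤ K) ∨
      (K < e.1 ∧ K + 2 ≤ c.1 ∧ c.1 ≤ e.1)))}

theorem mem_cutA {K i a b x y : ℤ} : ((a, b) : Cell) ∈ cutA K i (x, y) ↔
    (y = i ∧ ((b = i ∧ x ≤ a) ∨ (b ≠ i ∧ K + 1 ≤ a))) ∨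
    (y ≠ i ∧ b = y ∧ ((x ≤ K ∧ x ≤ a ∧ a ≤ K) ∨
      (K < x ∧ K + 2 ≤ a ∧ a ≤ x))) := Iff.rfl

theorem cutA_cross {N K i : ℤ} (hK : 1 ≤ K) (hKN : K + 4 ≤ N) {c d e : Cell}
    (hcd : EdgeAdj c d)
    (hc : (0 ≤ c.1 ∧ c.1 ≤ N) ∧ (c.2 % 2 = 0 ∨ c.1 = 0 ∨ c.1 = N) ∧
      (c.2 ≠ i → c.1 ≤ K ∨ K + 2 ≤ c.1))
    (hd : (0 ≤ d.1 ∧ d.1 ≤ N) ∧ (d.2 % 2 = 0 ∨ d.1 = 0 ∨ d.1 = N) ∧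
      (d.2 ≠ i → d.1 ≤ K ∨ K + 2 ≤ d.1))
    (he : 1 ≤ e.1 ∧ e.1 ≤ N ∧ e.2 % 2 = 0 ∧
      (e.2 ≠ i → e.1 ≤ N - 1 ∧ (e.1 ≤ K ∨ K + 3 ≤ e.1)))
    (hx : Crosses (cutA K i e) c d) :
    c.2 = e.2 ∧ d.2 = e.2 ∧
      ((e.2 = i ∨ e.1 ≤ K) → c.1 ≤ e.1 ∧ d.1 ≤ e.1 ∧ (e.1 = c.1 ∨ e.1 = d.1)) ∧
      (e.2 ≠ i ∧ K + 3 ≤ e.1 → e.1 ≤ c.1 ∧ e.1 ≤ d.1 ∧ (e.1 = c.1 ∨ e.1 = d.1)) := by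
  rw [edgeAdj_iff] at hcd
  obtain ⟨c1, c2⟩ := c
  obtain ⟨d1, d2⟩ := d
  obtain ⟨e1, e2⟩ := e
  rw [Crosses, mem_cutA, mem_cutA] at hx
  dsimp only at *
  by_cases hei : e2 = i
  · subst hei
    rcases hcd with ⟨rfl, rfl⟩ | ⟨rfl, rfl⟩ | ⟨rfl, rfl⟩ | ⟨rfl, rfl⟩ <;> omega
  · obtain ⟨h5, h6⟩ := he.2.2.2 hei
    obtain ⟨g1, g2, g3, -⟩ := he
    obtain ⟨⟨c3, c4⟩, c5, c6⟩ := hc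
    obtain ⟨⟨d3, d4⟩, d5, d6⟩ := hd
    have key : ∀ a b : ℤ, ((e2 = i ∧ ((b = i ∧ e1 ≤ a) ∨ (b ≠ i ∧ K + 1 ≤ a))) ∨
        (e2 ≠ i ∧ b = e2 ∧ ((e1 ≤ K ∧ e1 ≤ a ∧ a ≤ K) ∨
        (K < e1 ∧ K + 2 ≤ a ∧ a ≤ e1)))) ↔ (b = e2 ∧ ((e1 ≤ K ∧ e1 ≤ a ∧ a ≤ K) ∨
        (K < e1 ∧ K + 2 ≤ a ∧ a ≤ e1))) := by
      intro a b
      simp only [hei, ne_eq, not_false_eq_true, false_and, false_or, true_and]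
    rw [key, key] at hx
    rcases hcd with ⟨rfl, rfl⟩ | ⟨rfl, rfl⟩ | ⟨rfl, rfl⟩ | ⟨rfl, rfl⟩
    · by_cases hce : d2 = e2
      · subst hce
        specialize c6 hei
        specialize d6 hei
        rcases h6 with h6 | h6 <;> omega
      · omega
    · by_cases hce : d2 = e2
      · subst hce
        specialize c6 hei
        specialize d6 hei
        rcases h6 with h6 | h6 <;> omega
      · omega
    · exfalso
      clear c6 d6 key
      have : c2 % 2 = 0 → (c2 + 1) % 2 ≠ 0 := by omega
      have : (c2 + 1) % 2 = 0 → c2 % 2 ≠ 0 := by omega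
      rcases hx with ⟨h1, h2, h3⟩ | ⟨⟨h2, h3⟩, h1⟩ <;> clear h1 <;> subst h2 <;> omega
    · exfalso
      clear c6 d6 key
      have : c2 % 2 = 0 → (c2 - 1) % 2 ≠ 0 := by omega
      have : (c2 - 1) % 2 = 0 → c2 % 2 ≠ 0 := by omega
      rcases hx with ⟨h1, h2, h3⟩ | ⟨⟨h2, h3⟩, h1⟩ <;> clear h1 <;> subst h2 <;> omega

theorem caseA {A : Strategy} (hA : Admissible A) {ε : ℝ} (hε : 0 < ε) {N K i : ℤ}
    (hK : 1 ≤ K) (hKN : K + 4 ≤ N) (hi : i % 2 = 0 ∧ -2 ≤ i ∧ i ≤ 2) {L R : ℤ → ℤ}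
    (hS : Shape N i L R) {nQ t : ℕ} (hQ : StopsAt A (Theta N) (0, 0) nQ) (ht : t ≤ nQ)
    (hin : ∀ u ≤ nQ, traj A (Theta N) (0, 0) u ∈ Theta N)
    (hend : traj A (Theta N) (0, 0) t = (0, i))
    (hLK : ∀ y, y ≠ i → L y < K) (hRK : ∀ y, y ≠ i → K + 3 ≤ R y)
    (hLi : K ≤ L i ∧ L i ≤ N)
    (hvis : ∀ u ≤ t, (traj A (Theta N) (0, 0) u).1 ≤ L (traj A (Theta N) (0, 0) u).2 ∨
      R (traj A (Theta N) (0, 0) u).2 ≤ (traj A (Theta N) (0, 0) u).1)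
    (hlv : ∀ y, 1 ≤ L y → ∃ u ≤ t, traj A (Theta N) (0, 0) u = (L y, y))
    (hrv : ∀ y, R y < N → ∃ u ≤ t, traj A (Theta N) (0, 0) u = (R y, y))
    (hC : 40 ≤ ε * K) (n m : ℕ) (hn : StopsAt A (PP N L R) (0, 0) n)
    (hm : ∀ k (w : ℕ → Cell), w 0 = (0, 0) → IsWalk (PP N L R) w k → w k = (0, 0) →
      Covers (PP N L R) w k → m ≤ k) :
    (2 - ε) * (m : ℝ) ≤ (n : ℝ) := by
  classical
  have hconn := PP_connected (by omega) hi.2 hS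
  obtain ⟨hs, hd⟩ := PP_start (by omega) hS
  obtain ⟨hL0, hodd, hsh⟩ := id hS
  have hunv : ∀ x y, ¬ (x ≤ L y ∨ R y ≤ x) → ∀ u ≤ t, traj A (Theta N) (0, 0) u ≠ (x, y) := by
    intro x y hxy u hu h
    have := hvis u hu
    rw [h] at this
    exact hxy this
  let E : Finset Cell := ((Finset.Icc 1 N) ×ˢ (Finset.Icc (-2 : ℤ) 2)).filter (fun e =>
    e.2 % 2 = 0 ∧ (e.1 ≤ L e.2 ∨ (e.2 ≠ i ∧ R e.2 ≤ e.1 ∧ e.1 ≤ N - 1)))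
  have hE : ∀ e, e ∈ E ↔ (1 ≤ e.1 ∧ e.1 ≤ N) ∧ (-2 ≤ e.2 ∧ e.2 ≤ 2) ∧ e.2 % 2 = 0 ∧
      (e.1 ≤ L e.2 ∨ (e.2 ≠ i ∧ R e.2 ≤ e.1 ∧ e.1 ≤ N - 1)) := by
    intro e
    simp only [E, Finset.mem_filter, Finset.mem_product, Finset.mem_Icc]
    tauto
  have h4 : 4 * E.card ≤ n := by
    refine adversary hA hQ ht hconn hs hd ?_ E (cutA K i) ?_ ?_ ?_ ?_ ?_ n hn
    · intro u hu
      exact PP_agree (by omega) hS (hin u (by omega)) (hvis u hu.le)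
    · rintro ⟨x, y⟩ he
      rw [hE] at he
      dsimp only at he
      rw [mem_cutA]
      omega
    · rintro ⟨x, y⟩ he
      rw [hE] at he
      dsimp only at he
      rw [hend]
      rw [mem_cutA]
      omega
    · rintro ⟨x, y⟩ he
      rw [hE] at he
      simp only at he
      by_cases hl : x ≤ L y
      · obtain ⟨u, hu, h⟩ := hlv y (by omega)
        refine ⟨u, hu, ?_⟩
        rw [h]
        rw [mem_cutA]
        by_cases hy : y = i
        · omega
        · have := hLK y hy
          omega
      · have hy : y ≠ i := by omega
        have := hRK y hy
        obtain ⟨u, hu, h⟩ := hrv y (by omega)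
        refine ⟨u, hu, ?_⟩
        rw [h]
        rw [mem_cutA]
        omega
    · rintro ⟨x, y⟩ he
      rw [hE] at he
      simp only at he
      by_cases hy : y = i
      · rcases hsh with ⟨h1, h2⟩ | ⟨h1, h2⟩
        · have := h1 i
          have := h2 i
          refine ⟨(L i + 1, i), ?_, ?_, hunv _ _ (by omega)⟩
          · rw [mem_PP]; dsimp only; omega
          · rw [mem_cutA]; subst hy; omega
        · obtain ⟨z, hz, hzi⟩ : ∃ z, (z % 2 = 0 ∧ -2 ≤ z ∧ z ≤ 2) ∧ z ≠ i := by
            by_cases h : i = 0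
            · exact ⟨2, by omega, by omega⟩
            · exact ⟨0, by omega, by omega⟩
          have := h1 z
          have := hRK z hzi
          have := hLK z hzi
          refine ⟨(R z - 1, z), ?_, ?_, hunv _ _ (by omega)⟩
          · rw [mem_PP]; dsimp only; omega
          · rw [mem_cutA]; subst hy; omega
      · have := hRK y hy
        have := hLK y hy
        have := hL0 y
        by_cases hl : x ≤ L y
        · refine ⟨(L y + 1, y), ?_, ?_, hunv _ _ (by omega)⟩
          · rw [mem_PP]; dsimp only; omega
          · rw [mem_cutA]; omega
        · refine ⟨(R y - 1, y), ?_, ?_, hunv _ _ (by omega)⟩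
          · rw [mem_PP]; dsimp only; omega
          · rw [mem_cutA]; omega
    · intro c hc d hd hcd e he e' he' hx hx'
      rw [mem_PP] at hc hd
      rw [hE] at he he'
      have P1 : ∀ c : Cell, (c.1 ≤ L c.2 + 1 ∨ R c.2 - 1 ≤ c.1) →
          (c.2 ≠ i → c.1 ≤ K ∨ K + 2 ≤ c.1) := by
        intro c h1 h2
        have := hRK _ h2
        have := hLK _ h2
        omega
      have P2 : ∀ e : Cell, (e.1 ≤ L e.2 ∨ (e.2 ≠ i ∧ R e.2 ≤ e.1 ∧ e.1 ≤ N - 1)) →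
          (e.2 ≠ i → e.1 ≤ N - 1 ∧ (e.1 ≤ K ∨ K + 3 ≤ e.1)) := by
        intro c h1 h2
        have := hRK _ h2
        have := hLK _ h2
        omega
      have q1 := P2 e he.2.2.2
      have q2 := P2 e' he'.2.2.2
      have r1 := cutA_cross hK hKN hcd ⟨hc.1, hc.2.2.1, P1 c hc.2.2.2⟩
        ⟨hd.1, hd.2.2.1, P1 d hd.2.2.2⟩
        ⟨he.1.1, he.1.2, he.2.2.1, q1⟩ hx
      have r2 := cutA_cross hK hKN hcd ⟨hc.1, hc.2.2.1, P1 c hc.2.2.2⟩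
        ⟨hd.1, hd.2.2.1, P1 d hd.2.2.2⟩
        ⟨he'.1.1, he'.1.2, he'.2.2.1, q2⟩ hx'
      clear hx hx' he he' hc hd P1 P2
      have e2 : e.2 = e'.2 := by omega
      refine Prod.ext ?_ e2
      omega
  have hcard : (PP N L R).card ≤ E.card + 20 := by
    let T : Finset Cell := (Finset.Icc (-2 : ℤ) 2).image (fun y => ((0, y) : Cell)) ∪
      (Finset.Icc (-2 : ℤ) 2).image (fun y => ((N, y) : Cell)) ∪
      (Finset.Icc (-2 : ℤ) 2).image (fun y => ((L y + 1, y) : Cell)) ∪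
      (Finset.Icc (-2 : ℤ) 2).image (fun y => ((R y - 1, y) : Cell))
    have hT : T.card ≤ 20 := by
      have hc : ∀ f : ℤ → Cell, ((Finset.Icc (-2 : ℤ) 2).image f).card ≤ 5 := by
        intro f
        exact Finset.card_image_le.trans (by simp)
      refine (Finset.card_union_le _ _).trans ?_
      have h1 := Finset.card_union_le ((Finset.Icc (-2 : ℤ) 2).image (fun y => ((0, y) : Cell)) ∪
        (Finset.Icc (-2 : ℤ) 2).image (fun y => ((N, y) : Cell)))
        ((Finset.Icc (-2 : ℤ) 2).image (fun y => ((L y + 1, y) : Cell)))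
      have h2 := Finset.card_union_le ((Finset.Icc (-2 : ℤ) 2).image (fun y => ((0, y) : Cell)))
        ((Finset.Icc (-2 : ℤ) 2).image (fun y => ((N, y) : Cell)))
      have := hc (fun y => ((0, y) : Cell))
      have := hc (fun y => ((N, y) : Cell))
      have := hc (fun y => ((L y + 1, y) : Cell))
      have := hc (fun y => ((R y - 1, y) : Cell))
      omega
    have hsub : PP N L R ⊆ E ∪ T := by
      rintro ⟨x, y⟩ hc
      rw [mem_PP] at hc
      simp only at hc
      simp only [Finset.mem_union, hE, T, Finset.mem_image, Finset.mem_Icc, Prod.mk.injEq]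
      by_cases h1 : x = 0
      · right; left; left; left; exact ⟨y, hc.2.1, h1.symm, rfl⟩
      by_cases h2 : x = N
      · right; left; left; right; exact ⟨y, hc.2.1, h2.symm, rfl⟩
      by_cases h3 : x = L y + 1
      · right; left; right; exact ⟨y, hc.2.1, h3.symm, rfl⟩
      by_cases h4 : x = R y - 1
      · right; right; exact ⟨y, hc.2.1, h4.symm, rfl⟩
      left
      by_cases hy : y = i
      · rcases hsh with ⟨h1, h2⟩ | ⟨h1, h2⟩
        · have := h1 y
          omega
        · subst hy; omega
      · omega
    have h1 := Finset.card_le_card hsub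
    have h2 := Finset.card_union_le E T
    omega
  have hEK : K.toNat ≤ E.card := by
    have hsub : (Finset.Icc 1 K).image (fun x => ((x, i) : Cell)) ⊆ E := by
      intro c hc
      simp only [Finset.mem_image, Finset.mem_Icc] at hc
      obtain ⟨x, hx, rfl⟩ := hc
      rw [hE]
      simp only
      omega
    have h1 := Finset.card_le_card hsub
    rw [Finset.card_image_of_injective _ (fun a b h => (Prod.mk.inj h).1), Int.card_Icc] at h1
    omega
  obtain ⟨k', hk', w', a1, a2, a3, a4⟩ := detour hconn (0, 0) hs (PP N L R).card ∅
    (fun _ => (0, 0)) 0 (by simp) rfl ⟨fun _ _ => hs, by intro i hi; omega⟩ rfl (by simp)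
  have hmk := hm k' w' a1 a2 a3 a4
  refine final_arith ε 40 E.card m n hε (by omega) h4 ?_
  have : (K : ℝ) ≤ E.card := by
    have : K ≤ (E.card : ℤ) := by omega
    exact_mod_cast this
  push_cast
  nlinarith
def cycW (N a b T : ℤ) : Cell :=
  if T ≤ b then (0, T) else if T ≤ b + N then (T - b, b)
  else if T ≤ 2 * b + N - a then (N, b - (T - b - N))
  else if T ≤ 2 * b + 2 * N - a then (N - (T - (2 * b + N - a)), a)
  else (0, a + (T - (2 * b + 2 * N - a)))

theorem cycle_walk (N a b : ℤ) (hN : 1 ≤ N) (ha : a ≤ 0) (hb : 0 ≤ b) (hab : a < b) :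
    ∃ k : ℕ, (k : ℤ) = 2 * N + 2 * (b - a) ∧ ∃ w : ℕ → Cell, w 0 = (0, 0) ∧ w k = (0, 0) ∧
      (∀ i < k, EdgeAdj (w i) (w (i + 1))) ∧
      (∀ i ≤ k, (a ≤ (w i).2 ∧ (w i).2 ≤ b) ∧ (0 ≤ (w i).1 ∧ (w i).1 ≤ N) ∧
        ((w i).1 = 0 ∨ (w i).1 = N ∨ (w i).2 = a ∨ (w i).2 = b)) ∧
      (∀ x, 0 ≤ x → x ≤ N → ∃ i ≤ k, w i = (x, a)) ∧
      (∀ x, 0 ≤ x → x ≤ N → ∃ i ≤ k, w i = (x, b)) := by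
  refine ⟨(2 * N + 2 * (b - a)).toNat, by omega, fun T => cycW N a b (T : ℤ), ?_, ?_, ?_, ?_, ?_, ?_⟩
  · unfold cycW; simp [hb]
  · have : (((2 * N + 2 * (b - a)).toNat : ℕ) : ℤ) = 2 * N + 2 * (b - a) := by omega
    dsimp only
    rw [this]
    unfold cycW
    split_ifs <;> ext <;> dsimp only <;> omega
  · intro T hT
    have h1 : (T : ℤ) < 2 * N + 2 * (b - a) := by omega
    have h0 : (0 : ℤ) ≤ T := by omega
    push_cast
    generalize (T : ℤ) = T at h1 h0 ⊢
    rw [edgeAdj_iff]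
    unfold cycW
    split_ifs <;> dsimp only <;> omega
  · intro T hT
    have h1 : (T : ℤ) ≤ 2 * N + 2 * (b - a) := by omega
    have h0 : (0 : ℤ) ≤ T := by omega
    dsimp only
    generalize (T : ℤ) = T at h1 h0 ⊢
    unfold cycW
    split_ifs <;> dsimp only <;> omega
  · intro x h0 hx
    refine ⟨(2 * b + N - a + (N - x)).toNat, by omega, ?_⟩
    have : (((2 * b + N - a + (N - x)).toNat : ℕ) : ℤ) = 2 * b + N - a + (N - x) := by omega
    dsimp only
    rw [this]
    unfold cycW
    split_ifs <;> ext <;> dsimp only <;> omega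
  · intro x h0 hx
    refine ⟨(b + x).toNat, by omega, ?_⟩
    have : (((b + x).toNat : ℕ) : ℤ) = b + x := by omega
    dsimp only
    rw [this]
    unfold cycW
    split_ifs <;> ext <;> dsimp only <;> omega

def cutB (K i k : ℤ) (e : Cell) : Set Cell :=
  {c | (e.2 = i ∧ ((c.2 ≠ k ∧ e.1 ≤ c.1) ∨ (c.2 = k ∧ K + 1 ≤ c.1))) ∨
    (e.2 = k ∧ c.2 = k ∧ K + 2 ≤ c.1 ∧ c.1 ≤ e.1)}

theorem mem_cutB {K i k a b x y : ℤ} : ((a, b) : Cell) ∈ cutB K i k (x, y) ↔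
    (y = i ∧ ((b ≠ k ∧ x ≤ a) ∨ (b = k ∧ K + 1 ≤ a))) ∨
    (y = k ∧ b = k ∧ K + 2 ≤ a ∧ a ≤ x) := Iff.rfl

theorem cutB_cross {N K i k : ℤ} (hK : 1 ≤ K) (hKN : K + 4 ≤ N) (hik : i ≠ k)
    (hk2 : k % 2 = 0) {c d e : Cell}
    (hcd : EdgeAdj c d)
    (hc : (0 ≤ c.1 ∧ c.1 ≤ N) ∧ (c.2 % 2 = 0 ∨ c.1 = 0 ∨ c.1 = N) ∧
      (c.2 = k → c.1 ≤ K ∨ K + 2 ≤ c.1))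
    (hd : (0 ≤ d.1 ∧ d.1 ≤ N) ∧ (d.2 % 2 = 0 ∨ d.1 = 0 ∨ d.1 = N) ∧
      (d.2 = k → d.1 ≤ K ∨ K + 2 ≤ d.1))
    (he : K + 3 ≤ e.1 ∧ e.1 ≤ N ∧ (e.2 = i ∨ (e.2 = k ∧ e.1 ≤ N - 1)))
    (hx : Crosses (cutB K i k e) c d) :
    c.2 = d.2 ∧
      (e.2 = i → c.2 ≠ k ∧ c.1 ≤ e.1 ∧ d.1 ≤ e.1 ∧ (e.1 = c.1 ∨ e.1 = d.1)) ∧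
      (e.2 = k → c.2 = k ∧ e.1 ≤ c.1 ∧ e.1 ≤ d.1 ∧ (e.1 = c.1 ∨ e.1 = d.1)) := by
  rw [edgeAdj_iff] at hcd
  obtain ⟨c1, c2⟩ := c
  obtain ⟨d1, d2⟩ := d
  obtain ⟨e1, e2⟩ := e
  rw [Crosses, mem_cutB, mem_cutB] at hx
  dsimp only at *
  obtain ⟨⟨c3, c4⟩, c5, c6⟩ := hc
  obtain ⟨⟨d3, d4⟩, d5, d6⟩ := hd
  obtain ⟨g1, g2, g3⟩ := he
  rcases g3 with rfl | ⟨rfl, g4⟩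
  · have key : ∀ a b : ℤ, ((e2 = e2 ∧ ((b ≠ k ∧ e1 ≤ a) ∨ (b = k ∧ K + 1 ≤ a))) ∨
      (e2 = k ∧ b = k ∧ K + 2 ≤ a ∧ a ≤ e1)) ↔ ((b ≠ k ∧ e1 ≤ a) ∨ (b = k ∧ K + 1 ≤ a)) := by
      intro a b
      simp only [hik, true_and, false_and, or_false]
    rw [key, key] at hx
    clear key
    rcases hcd with ⟨rfl, rfl⟩ | ⟨rfl, rfl⟩ | ⟨rfl, rfl⟩ | ⟨rfl, rfl⟩
    · by_cases hce : d2 = k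
      · subst hce; specialize c6 rfl; specialize d6 rfl; omega
      · clear c6 d6; omega
    · by_cases hce : d2 = k
      · subst hce; specialize c6 rfl; specialize d6 rfl; omega
      · clear c6 d6; omega
    · exfalso
      have : d1 = 0 ∨ d1 = N := by omega
      clear c6 d6 c5 d5
      rcases this with rfl | rfl <;> omega
    · exfalso
      have : d1 = 0 ∨ d1 = N := by omega
      clear c6 d6 c5 d5
      rcases this with rfl | rfl <;> omega
  · have key : ∀ a b : ℤ, ((e2 = i ∧ ((b ≠ e2 ∧ e1 ≤ a) ∨ (b = e2 ∧ K + 1 ≤ a))) ∨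
      (e2 = e2 ∧ b = e2 ∧ K + 2 ≤ a ∧ a ≤ e1)) ↔ (b = e2 ∧ K + 2 ≤ a ∧ a ≤ e1) := by
      intro a b
      simp only [hik.symm, true_and, false_and, false_or]
    rw [key, key] at hx
    clear key
    rcases hcd with ⟨rfl, rfl⟩ | ⟨rfl, rfl⟩ | ⟨rfl, rfl⟩ | ⟨rfl, rfl⟩
    · by_cases hce : d2 = e2
      · subst hce; specialize c6 rfl; specialize d6 rfl; omega
      · clear c6 d6; omega
    · by_cases hce : d2 = e2
      · subst hce; specialize c6 rfl; specialize d6 rfl; omega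
      · clear c6 d6; omega
    · exfalso
      have : d1 = 0 ∨ d1 = N := by omega
      clear c6 d6 c5 d5
      rcases this with rfl | rfl <;> omega
    · exfalso
      have : d1 = 0 ∨ d1 = N := by omega
      clear c6 d6 c5 d5
      rcases this with rfl | rfl <;> omega

def LB (N k lk : ℤ) : ℤ → ℤ := fun y => if y = k then lk else if y % 2 = 0 then N else 0
def RB (N k rk : ℤ) : ℤ → ℤ := fun y => if y = k then rk else N

theorem shapeB {N K i k lk rk : ℤ} (hK : 1 ≤ K) (hKN : K + 4 ≤ N)
    (hi : i % 2 = 0) (hk : k % 2 = 0) (hik : i ≠ k)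
    (hlk : 0 ≤ lk ∧ lk < K) (hrk : K + 3 ≤ rk ∧ rk ≤ N) :
    Shape N i (LB N k lk) (RB N k rk) := by
  refine ⟨?_, ?_, Or.inr ⟨?_, ?_⟩⟩
  · intro y; unfold LB; split_ifs <;> omega
  · intro y hy; unfold LB; split_ifs <;> omega
  · intro y; unfold RB; split_ifs <;> omega
  · unfold LB; rw [if_neg hik, if_pos hi]

theorem mem_PPB {N K k lk rk x y : ℤ} (hK : 1 ≤ K) (hKN : K + 4 ≤ N)
    (hk : k % 2 = 0)
    (hlk : 0 ≤ lk ∧ lk < K) (hrk : K + 3 ≤ rk ∧ rk ≤ N) :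
    ((x, y) : Cell) ∈ PP N (LB N k lk) (RB N k rk) ↔
    (0 ≤ x ∧ x ≤ N) ∧ (-2 ≤ y ∧ y ≤ 2) ∧
    (y % 2 = 0 ∨ x = 0 ∨ x = N) ∧ (y = k → (x ≤ lk + 1 ∨ rk - 1 ≤ x)) := by
  rw [mem_PP]
  unfold LB RB
  dsimp only
  split_ifs <;> omega

set_option maxHeartbeats 1000000 in
theorem caseB {A : Strategy} (hA : Admissible A) {ε : ℝ} (hε : 0 < ε) {N K i j k lk rk : ℤ}
    (hK : 1 ≤ K) (hKN : K + 4 ≤ N) (hi : i % 2 = 0 ∧ -2 ≤ i ∧ i ≤ 2)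
    (hj : j % 2 = 0 ∧ -2 ≤ j ∧ j ≤ 2) (hk : k % 2 = 0 ∧ -2 ≤ k ∧ k ≤ 2)
    (hij : j ≠ i) (hik : i ≠ k) (hjk : j ≠ k)
    (hlk : 0 ≤ lk ∧ lk < K) (hrk : K + 3 ≤ rk ∧ rk ≤ N)
    {nQ t : ℕ} (hQ : StopsAt A (Theta N) (0, 0) nQ) (ht : t ≤ nQ)
    (hin : ∀ u ≤ nQ, traj A (Theta N) (0, 0) u ∈ Theta N)
    (hend : traj A (Theta N) (0, 0) t = (K + 2, j))
    (hvis : ∀ u ≤ t, (traj A (Theta N) (0, 0) u).2 = k →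
      (traj A (Theta N) (0, 0) u).1 ≤ lk ∨ rk ≤ (traj A (Theta N) (0, 0) u).1)
    (hNi : ∃ u ≤ t, traj A (Theta N) (0, 0) u = (N, i))
    (hrv : rk < N → ∃ u ≤ t, traj A (Theta N) (0, 0) u = (rk, k))
    (hC : ((4 * K + 26 : ℤ) : ℝ) ≤ ε * ((N - K - 2 : ℤ) : ℝ)) (n m : ℕ)
    (hn : StopsAt A (PP N (LB N k lk) (RB N k rk)) (0, 0) n)
    (hm : ∀ q (w : ℕ → Cell), w 0 = (0, 0) → IsWalk (PP N (LB N k lk) (RB N k rk)) w q →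
      w q = (0, 0) → Covers (PP N (LB N k lk) (RB N k rk)) w q → m ≤ q) :
    (2 - ε) * (m : ℝ) ≤ (n : ℝ) := by
  classical
  have hS := shapeB hK hKN hi.1 hk.1 hik hlk hrk
  have hmem := fun x y => mem_PPB (x := x) (y := y) hK hKN hk.1 hlk hrk
  have hconn := PP_connected (by omega) hi.2 hS
  obtain ⟨hs, hd⟩ := PP_start (by omega) hS
  let E1 : Finset Cell := (Finset.Icc (K + 3) N).image (fun x => ((x, i) : Cell))
  let E2 : Finset Cell := (Finset.Icc rk (N - 1)).image (fun x => ((x, k) : Cell))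
  have hE : ∀ x y, ((x, y) : Cell) ∈ E1 ∪ E2 ↔
      ((K + 3 ≤ x ∧ x ≤ N) ∧ y = i) ∨ ((rk ≤ x ∧ x ≤ N - 1) ∧ y = k) := by
    intro x y
    simp only [E1, E2, Finset.mem_union, Finset.mem_image, Finset.mem_Icc, Prod.mk.injEq]
    constructor
    · rintro (⟨a, h, rfl, rfl⟩ | ⟨a, h, rfl, rfl⟩)
      · exact Or.inl ⟨h, rfl⟩
      · exact Or.inr ⟨h, rfl⟩
    · rintro (⟨h, rfl⟩ | ⟨h, rfl⟩)
      · exact Or.inl ⟨x, h, rfl, rfl⟩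
      · exact Or.inr ⟨x, h, rfl, rfl⟩
  have hEc : ((E1 ∪ E2).card : ℤ) = (N - K - 2) + (N - rk) := by
    rw [Finset.card_union_of_disjoint]
    · simp only [E1, E2]
      rw [Finset.card_image_of_injective _ (fun a b h => (Prod.mk.inj h).1),
        Finset.card_image_of_injective _ (fun a b h => (Prod.mk.inj h).1), Int.card_Icc,
        Int.card_Icc]
      omega
    · rw [Finset.disjoint_left]
      rintro ⟨x, y⟩ h1 h2
      simp only [E1, E2, Finset.mem_image, Prod.mk.injEq] at h1 h2
      obtain ⟨a, -, -, h1⟩ := h1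
      obtain ⟨b, -, -, h2⟩ := h2
      omega
  have h4 : 4 * (E1 ∪ E2).card ≤ n := by
    refine adversary hA hQ ht hconn hs hd ?_ (E1 ∪ E2) (cutB K i k) ?_ ?_ ?_ ?_ ?_ n hn
    · intro u hu
      refine PP_agree (by omega) hS (hin u (by omega)) ?_
      have h1 := hvis u hu.le
      have h2 := hin u (by omega)
      rw [mem_Theta] at h2
      unfold LB RB
      split_ifs <;> omega
    · rintro ⟨x, y⟩ he
      rw [hE] at he
      rw [mem_cutB]
      clear hNi hrv hm hvis hmem hE
      omega
    · rintro ⟨x, y⟩ he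
      rw [hE] at he
      rw [hend, mem_cutB]
      clear hNi hrv hm hvis hmem hE
      omega
    · rintro ⟨x, y⟩ he
      rw [hE] at he
      rcases he with ⟨he, rfl⟩ | ⟨he, rfl⟩
      · obtain ⟨u, hu, h⟩ := hNi
        refine ⟨u, hu, ?_⟩
        rw [h, mem_cutB]
        omega
      · obtain ⟨u, hu, h⟩ := hrv (by omega)
        refine ⟨u, hu, ?_⟩
        rw [h, mem_cutB]
        omega
    · rintro ⟨x, y⟩ he
      rw [hE] at he
      refine ⟨(rk - 1, k), ?_, ?_, ?_⟩
      · rw [hmem]; omega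
      · rw [mem_cutB]; omega
      · intro u hu h
        have := hvis u hu
        rw [h] at this
        have := this rfl
        dsimp only at this
        omega
    · rintro ⟨c1, c2⟩ hc ⟨d1, d2⟩ hd hcd ⟨x, y⟩ he ⟨x', y'⟩ he' hx hx'
      rw [hmem] at hc hd
      rw [hE] at he he'
      clear hNi hrv hm hvis hmem hE
      have hc' : c2 = k → c1 ≤ K ∨ K + 2 ≤ c1 := by
        intro h; have := hc.2.2.2 h; omega
      have hd' : d2 = k → d1 ≤ K ∨ K + 2 ≤ d1 := by
        intro h; have := hd.2.2.2 h; omega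
      have r1 := cutB_cross hK hKN hik hk.1 hcd ⟨hc.1, hc.2.2.1, hc'⟩
        ⟨hd.1, hd.2.2.1, hd'⟩ (by dsimp only; omega) hx
      have r2 := cutB_cross hK hKN hik hk.1 hcd ⟨hc.1, hc.2.2.1, hc'⟩
        ⟨hd.1, hd.2.2.1, hd'⟩ (by dsimp only; omega) hx'
      dsimp only at r1 r2
      clear hx hx' hc hd hc' hd'
      have he1 : y = i ∨ y = k := by omega
      have he2 : y' = i ∨ y' = k := by omega
      have hy : y = y' := by
        rcases he1 with rfl | rfl <;> rcases he2 with rfl | rfl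
        · rfl
        · exact absurd (r2.2.2 rfl).1 (r1.2.1 rfl).1
        · exact absurd (r1.2.2 rfl).1 (r2.2.1 rfl).1
        · rfl
      subst hy
      have hxx : x = x' := by
        rcases he1 with rfl | rfl
        · have := r1.2.1 rfl
          have := r2.2.1 rfl
          omega
        · have := r1.2.2 rfl
          have := r2.2.2 rfl
          omega
      rw [hxx]
  clear hNi hrv hvis hE
  let U : Finset Cell := (Finset.Icc 0 N).image (fun x => ((x, i) : Cell)) ∪
    (Finset.Icc 0 N).image (fun x => ((x, j) : Cell))
  obtain ⟨a, b, hab⟩ : ∃ a b : ℤ, (a = i ∧ b = j ∧ i < j) ∨ (a = j ∧ b = i ∧ j < i) := by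
    rcases lt_or_gt_of_ne hij with h | h
    · exact ⟨j, i, by omega⟩
    · exact ⟨i, j, by omega⟩
  obtain ⟨q, hq, w, w0, wq, wst, win, wa, wb⟩ := cycle_walk N a b (by omega) (by omega) (by omega)
    (by omega)
  have hU : ∀ c ∈ U, ∃ u ≤ q, w u = c := by
    rintro ⟨x, y⟩ hc
    simp only [U, Finset.mem_union, Finset.mem_image, Finset.mem_Icc, Prod.mk.injEq] at hc
    have hx : 0 ≤ x ∧ x ≤ N ∧ (y = a ∨ y = b) := by
      rcases hc with ⟨x', h, rfl, rfl⟩ | ⟨x', h, rfl, rfl⟩ <;> omega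
    rcases hx.2.2 with rfl | rfl
    · exact wa x hx.1 hx.2.1
    · exact wb x hx.1 hx.2.1
  have hW : IsWalk (PP N (LB N k lk) (RB N k rk)) w q := by
    refine ⟨fun u hu => ?_, wst⟩
    have h := win u hu
    rcases hwu : w u with ⟨x, y⟩
    rw [hwu] at h
    dsimp only at h
    rw [hmem]
    omega
  have hr : (PP N (LB N k lk) (RB N k rk) \ U).card ≤ ((K + 1) + (N - rk + 2) + 4).toNat := by
    let T : Finset Cell := (Finset.Icc 0 (lk + 1)).image (fun x => ((x, k) : Cell)) ∪
      (Finset.Icc (rk - 1) N).image (fun x => ((x, k) : Cell)) ∪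
      {(0, 1), (0, -1), (N, 1), (N, -1)}
    have hT : T.card ≤ ((K + 1) + (N - rk + 2) + 4).toNat := by
      have h1 := Finset.card_union_le ((Finset.Icc 0 (lk + 1)).image (fun x => ((x, k) : Cell)) ∪
        (Finset.Icc (rk - 1) N).image (fun x => ((x, k) : Cell)))
        {(0, 1), (0, -1), (N, 1), (N, -1)}
      have h2 := Finset.card_union_le ((Finset.Icc 0 (lk + 1)).image (fun x => ((x, k) : Cell)))
        ((Finset.Icc (rk - 1) N).image (fun x => ((x, k) : Cell)))
      have h3 : ((Finset.Icc 0 (lk + 1)).image (fun x => ((x, k) : Cell))).card ≤ _ :=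
        Finset.card_image_le
      have h5 : ((Finset.Icc (rk - 1) N).image (fun x => ((x, k) : Cell))).card ≤ _ :=
        Finset.card_image_le
      have h6 : ({(0, 1), (0, -1), (N, 1), (N, -1)} : Finset Cell).card ≤ 4 := Finset.card_le_four
      rw [Int.card_Icc] at h3 h5
      show Finset.card (_ ∪ _) ≤ _
      omega
    refine (Finset.card_le_card ?_).trans hT
    rintro ⟨x, y⟩ hc
    rw [Finset.mem_sdiff, hmem] at hc
    obtain ⟨hc, hcU⟩ := hc
    simp only [U, Finset.mem_union, Finset.mem_image, Finset.mem_Icc, Prod.mk.injEq, not_or] at hcU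
    have n1 : y ≠ i := fun h => hcU.1 ⟨x, hc.1, rfl, h.symm⟩
    have n2 : y ≠ j := fun h => hcU.2 ⟨x, hc.1, rfl, h.symm⟩
    simp only [T, Finset.mem_union, Finset.mem_image, Finset.mem_Icc, Finset.mem_insert,
      Finset.mem_singleton, Prod.mk.injEq]
    by_cases hy : y = k
    · left
      rcases hc.2.2.2 hy with h | h
      · left; exact ⟨x, ⟨hc.1.1, h⟩, rfl, hy.symm⟩
      · right; exact ⟨x, ⟨h, hc.1.2⟩, rfl, hy.symm⟩
    · right
      have hy1 : y = 1 ∨ y = -1 := by omega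
      have hx1 : x = 0 ∨ x = N := by omega
      clear hcU hmem
      omega
  obtain ⟨k', hk', w', a1, a2, a3, a4⟩ := detour hconn (0, 0) hs _ U w q hr w0 hW wq hU
  have hmk := hm k' w' a1 a2 a3 a4
  refine final_arith ε (4 * K + 26).toNat (E1 ∪ E2).card m n hε (by omega) h4 ?_
  have e1 : (((4 * K + 26).toNat : ℕ) : ℝ) = ((4 * K + 26 : ℤ) : ℝ) := by
    have : (((4 * K + 26).toNat : ℕ) : ℤ) = 4 * K + 26 := by omega
    exact_mod_cast this
  have e2 : ((N - K - 2 : ℤ) : ℝ) ≤ ((E1 ∪ E2).card : ℝ) := by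
    have : N - K - 2 ≤ ((E1 ∪ E2).card : ℤ) := by omega
    exact_mod_cast this
  rw [e1]
  exact hC.trans (mul_le_mul_of_nonneg_left e2 hε.le)

theorem Theta_eq (N : ℤ) :
    Theta N = PP N (fun y => if y % 2 = 0 then N else 0) (fun _ => N) := by
  ext ⟨x, y⟩
  rw [mem_Theta, mem_PP]
  dsimp only
  split_ifs <;> omega

theorem Theta_shape {N : ℤ} (hN : 2 ≤ N) :
    Shape N 0 (fun y => if y % 2 = 0 then N else 0) (fun _ => N) := by
  refine ⟨?_, ?_, Or.inr ⟨?_, ?_⟩⟩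
  · intro y; dsimp only; split_ifs <;> omega
  · intro y hy; exact if_neg hy
  · intro y; exact le_rfl
  · simp

/-- for every admissible deterministic online strategy `A` and every
`ε > 0` there are a grid polygon (with holes) `P` and a start cell `s ∈ P`
edge-adjacent to a cell outside `P` with `S_A(P,s) ≥ (2 - ε) · S_OPT(P,s)`;
hence no online strategy has competitive factor smaller than 2. -/
theorem online_lower_bound_with_holes (A : Strategy) (hA : Admissible A)
    (ε : ℝ) (hε : 0 < ε) :
    ∃ (P : Finset Cell) (s : Cell), GridPolygon P ∧ s ∈ P ∧
      (∃ d, d ∉ P ∧ EdgeAdj s d) ∧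
      ∀ n m : ℕ, StopsAt A P s n →
        IsLeast {k : ℕ | ∃ w : ℕ → Cell,
          w 0 = s ∧ IsWalk P w k ∧ w k = s ∧ Covers P w k} m →
        (2 - ε) * (m : ℝ) ≤ (n : ℝ) := by
  obtain ⟨K0, hK0⟩ := exists_nat_gt (40 / ε)
  obtain ⟨K, hKdef⟩ : ∃ K : ℤ, K = K0 + 1 := ⟨_, rfl⟩
  have hK : 1 ≤ K := by omega
  have hC1 : 40 ≤ ε * (K : ℝ) := by
    rw [div_lt_iff₀ hε] at hK0
    rw [hKdef]
    push_cast
    nlinarith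
  obtain ⟨N0, hN0⟩ := exists_nat_gt (((4 * K + 26 : ℤ) : ℝ) / ε)
  obtain ⟨N, hNdef⟩ : ∃ N : ℤ, N = K + 4 + N0 := ⟨_, rfl⟩
  have hKN : K + 4 ≤ N := by omega
  have hC2 : ((4 * K + 26 : ℤ) : ℝ) ≤ ε * ((N - K - 2 : ℤ) : ℝ) := by
    rw [div_lt_iff₀ hε] at hN0
    have : N - K - 2 = N0 + 2 := by omega
    rw [this]
    push_cast at hN0 ⊢
    nlinarith
  have hTS := Theta_shape (N := N) (by omega)
  have hTc : GridPolygon (Theta N) := by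
    rw [Theta_eq]
    exact PP_connected (by omega) (by omega) hTS
  have hTs : ((0, 0) : Cell) ∈ Theta N ∧ ∃ d, d ∉ Theta N ∧ EdgeAdj (0, 0) d := by
    rw [Theta_eq]
    exact PP_start (by omega) hTS
  obtain ⟨nQ, hQ, hin, hret, hcov⟩ := hA (Theta N) (0, 0) hTc hTs.1 hTs.2
  obtain ⟨t, ht, i, hi, hKi, hv, hNv, hend⟩ := phases N K hK hKN (traj A (Theta N) (0, 0)) nQ hin
    (fun u hu => traj_step hQ hu) rfl hret (hcov (N, 0) (by rw [mem_Theta]; dsimp only; omega))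
  choose L hL0 hLB hLv hLm using fun y =>
    exists_L (traj A (Theta N) (0, 0)) t y (if y = i then N else K) (by split_ifs <;> omega)
  choose R hRN hRB hRv hRm using fun y =>
    exists_R (traj A (Theta N) (0, 0)) t y (K + 1) N (by omega)
  have hint : ∀ u ≤ t, traj A (Theta N) (0, 0) u ∈ Theta N := fun u hu => hin u (hu.trans ht)
  -- rows other than `i`
  have hLi : K ≤ L i ∧ L i ≤ N := by
    obtain ⟨u, hu, h⟩ := hKi
    have h1 := hLm i u hu (by rw [h])
    have h2 := hLB i
    rw [if_pos rfl] at h1 h2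
    rw [h] at h1
    dsimp only at h1
    exact ⟨h1 (by omega), h2⟩
  rcases hend with hend | ⟨j, hji, hend⟩
  · have hv' : ∀ u ≤ t, (traj A (Theta N) (0, 0) u).1 < K ∨ (traj A (Theta N) (0, 0) u).2 = i ∨
        K + 3 ≤ (traj A (Theta N) (0, 0) u).1 := by
      intro u hu
      rcases lt_or_eq_of_le hu with h | h
      · exact hv u h
      · subst h; rw [hend]; right; left; rfl
    have hLK : ∀ y, y ≠ i → L y < K := by
      intro y hy
      have h2 := hLB y
      rw [if_neg hy] at h2
      rcases hLv y with h | ⟨u, hu, h⟩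
      · omega
      · have := hv' u hu
        rw [h] at this
        dsimp only at this
        omega
    have hodd : ∀ y, y % 2 ≠ 0 → L y = 0 := by
      intro y hy
      have := hLK y (by omega)
      rcases hLv y with h | ⟨u, hu, h⟩
      · omega
      · have := hint u hu
        rw [h, mem_Theta] at this
        dsimp only at this
        omega
    have hlv : ∀ y, 1 ≤ L y → ∃ u ≤ t, traj A (Theta N) (0, 0) u = (L y, y) := by
      intro y hy
      rcases hLv y with h | h
      · omega
      · exact h
    by_cases hLN : L i = N
    · have hRK : ∀ y, y ≠ i → K + 3 ≤ R y := by
        intro y hy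
        have h2 := hRB y
        rcases hRv y with h | ⟨u, hu, h⟩
        · omega
        · have := hv' u hu
          rw [h] at this
          dsimp only at this
          omega
      have hS : Shape N i L R := ⟨hL0, hodd, Or.inr ⟨hRN, by omega⟩⟩
      refine ⟨PP N L R, (0, 0), PP_connected (by omega) hi.2 hS, (PP_start (by omega) hS).1,
        (PP_start (by omega) hS).2, ?_⟩
      intro n m hn hm
      refine caseA hA hε hK hKN hi hS hQ ht hin hend hLK hRK hLi ?_ hlv ?_ hC1 n m hn ?_
      · intro u hu
        have h1 := hv' u hu
        have h2 := hLm _ u hu rfl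
        have h3 := hRm _ u hu rfl
        have h4 := hint u hu
        rw [mem_Theta] at h4
        generalize traj A (Theta N) (0, 0) u = c at h1 h2 h3 h4 ⊢
        obtain ⟨x, y⟩ := c
        dsimp only at h1 h2 h3 h4 ⊢
        split_ifs at h2 with hy <;> omega
      · intro y hy
        rcases hRv y with h | h
        · omega
        · exact h
      · intro k w h1 h2 h3 h4
        exact hm.2 ⟨w, h1, h2, h3, h4⟩
    · have hLlt : ∀ y, L y < N := by
        intro y
        by_cases hy : y = i
        · subst hy; omega
        · have := hLK y hy; omega
      have hS : Shape N i L (fun _ => N + 5) :=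
        ⟨hL0, hodd, Or.inl ⟨fun _ => by dsimp only; omega, hLlt⟩⟩
      have hv2 : ∀ u ≤ t, (traj A (Theta N) (0, 0) u).1 < K ∨
          (traj A (Theta N) (0, 0) u).2 = i := by
        rcases hNv with ⟨u, hu, h⟩ | h
        · exfalso
          have h1 := hLm i u hu.le (by rw [h])
          rw [if_pos rfl, h] at h1
          have := h1 le_rfl
          dsimp only at this
          omega
        · exact h
      refine ⟨PP N L (fun _ => N + 5), (0, 0), PP_connected (by omega) hi.2 hS,
        (PP_start (by omega) hS).1, (PP_start (by omega) hS).2, ?_⟩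
      intro n m hn hm
      refine caseA hA hε hK hKN hi hS hQ ht hin hend hLK (fun _ _ => by omega) hLi ?_
        hlv ?_ hC1 n m hn ?_
      · intro u hu
        have h1 := hv2 u hu
        have h2 := hLm _ u hu rfl
        have h4 := hint u hu
        rw [mem_Theta] at h4
        left
        generalize traj A (Theta N) (0, 0) u = c at h1 h2 h4 ⊢
        obtain ⟨x, y⟩ := c
        dsimp only at h1 h2 h4 ⊢
        split_ifs at h2 with hy <;> omega
      · intro y hy
        omega
      · intro k w h1 h2 h3 h4
        exact hm.2 ⟨w, h1, h2, h3, h4⟩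
  · have hjm := hint t le_rfl
    rw [hend, mem_Theta] at hjm
    dsimp only at hjm
    have hj : j % 2 = 0 ∧ -2 ≤ j ∧ j ≤ 2 := by omega
    obtain ⟨k, hk⟩ : ∃ k, k = - i - j := ⟨_, rfl⟩
    have hk2 : k % 2 = 0 ∧ -2 ≤ k ∧ k ≤ 2 := by omega
    have hik : i ≠ k := by omega
    have hjk : j ≠ k := by omega
    have hNi : ∃ u ≤ t, traj A (Theta N) (0, 0) u = (N, i) := by
      rcases hNv with ⟨u, hu, h⟩ | h
      · exact ⟨u, hu.le, h⟩
      · have := h t le_rfl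
        rw [hend] at this
        dsimp only at this
        omega
    have hvk : ∀ u ≤ t, (traj A (Theta N) (0, 0) u).2 = k → (traj A (Theta N) (0, 0) u).1 < K ∨
        K + 3 ≤ (traj A (Theta N) (0, 0) u).1 := by
      intro u hu h
      rcases lt_or_eq_of_le hu with h' | h'
      · have := hv u h'
        omega
      · subst h'
        rw [hend] at h
        exact absurd h hjk
    have hlk : 0 ≤ L k ∧ L k < K := by
      refine ⟨hL0 k, ?_⟩
      have h2 := hLB k
      rw [if_neg hik.symm] at h2
      rcases hLv k with h | ⟨u, hu, h⟩
      · omega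
      · have := hvk u hu (by rw [h])
        rw [h] at this
        dsimp only at this
        omega
    have hrk : K + 3 ≤ R k ∧ R k ≤ N := by
      refine ⟨?_, hRN k⟩
      have h2 := hRB k
      rcases hRv k with h | ⟨u, hu, h⟩
      · omega
      · have := hvk u hu (by rw [h])
        rw [h] at this
        dsimp only at this
        omega
    have hS := shapeB hK hKN hi.1 hk2.1 hik hlk hrk
    refine ⟨_, (0, 0), PP_connected (by omega) hi.2 hS, (PP_start (by omega) hS).1,
      (PP_start (by omega) hS).2, ?_⟩
    intro n m hn hm
    refine caseB hA hε hK hKN hi hj hk2 hji hik hjk hlk hrk hQ ht hin hend ?_ hNi ?_ hC2 n m hn ?_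
    · intro u hu h
      have h1 := hvk u hu h
      have h2 := hLm k u hu h
      have h3 := hRm k u hu h
      rw [if_neg hik.symm] at h2
      omega
    · intro hlt
      rcases hRv k with h | h
      · omega
      · exact h
    · intro k w h1 h2 h3 h4
      exact hm.2 ⟨w, h1, h2, h3, h4⟩
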